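/- arXiv:2006.00524 — 2 statements merged into one kernel-verified Lean document; each statement's English description precedes it below -/
import Mathlib

section
/- Let φ : ℝ³ → ℝ be a Schwartz function. Then ‖φ‖_{L³(ℝ³)} ≤ C · ‖∂₁φ‖_{L^{3/2}}^{1/3} · ‖∂₂φ‖_{L^{3/2}}^{1/3} · ‖∂₃φ‖_{L^{3/2}}^{1/3} for an absolute constant C. -/
open MeasureTheory NNReal

open scoped ENNReal
open Function Filter Topology

/-- A **Loomis–Whitney** inequality: the grid-lines quantity of a family of functions is bounded
by the product of powers of their integrals. -/
theorem lintegral_prod_lintegral_update_pow_le {ι : Type*} [Fintype ι] [DecidableEq ι]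
    {A : ι → Type*} [∀ i, MeasurableSpace (A i)] (μ : ∀ i, Measure (A i))
    [∀ i, SigmaFinite (μ i)] {p : ℝ} (hp : Real.HolderConjugate (Fintype.card ι) p)
    {f : ι → (∀ i, A i) → ℝ≥0∞} (hf : ∀ i, Measurable (f i))
    (h0 : ∀ i, ∫⁻ x, f i x ∂.pi μ ≠ 0) (htop : ∀ i, ∫⁻ x, f i x ∂.pi μ ≠ ∞) :
    ∫⁻ x, ∏ i, (∫⁻ t, f i (update x i t) ∂μ i) ^ (1 / (Fintype.card ι - 1 : ℝ)) ∂.pi μ ≤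
      (∏ i, ∫⁻ x, f i x ∂.pi μ) ^ (1 / (Fintype.card ι - 1 : ℝ)) *
        (Fintype.card ι : ℝ≥0∞) ^ p := by
  have hr : 0 ≤ 1 / (Fintype.card ι - 1 : ℝ) := by
    have := hp.lt
    exact one_div_nonneg.2 (by linarith)
  set r := 1 / (Fintype.card ι - 1 : ℝ)
  set I : ι → ℝ≥0∞ := fun i => ∫⁻ x, f i x ∂.pi μ
  set g : (∀ i, A i) → ℝ≥0∞ := fun x => ∑ i, (I i)⁻¹ * f i x
  have hgm : Measurable g := Finset.measurable_sum _ fun i _ => (hf i).const_mul _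
  have hle : ∀ i x, f i x ≤ I i * g x := fun i x => by
    calc f i x = I i * ((I i)⁻¹ * f i x) := by
          rw [← mul_assoc, ENNReal.mul_inv_cancel (h0 i) (htop i), one_mul]
      _ ≤ I i * g x := by
          gcongr
          exact Finset.single_le_sum (f := fun i => (I i)⁻¹ * f i x) (fun _ _ => zero_le)
            (Finset.mem_univ i)
  have hgint : ∫⁻ x, g x ∂.pi μ = Fintype.card ι := by
    rw [lintegral_finsetSum _ fun i _ => (hf i).const_mul _]
    simp_rw [lintegral_const_mul _ (hf _)]
    rw [Finset.sum_congr rfl fun i _ => ENNReal.inv_mul_cancel (h0 i) (htop i)]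
    simp
  calc ∫⁻ x, ∏ i, (∫⁻ t, f i (update x i t) ∂μ i) ^ r ∂.pi μ
      ≤ ∫⁻ x, (∏ i, I i) ^ r * ∏ i, (∫⁻ t, g (update x i t) ∂μ i) ^ r ∂.pi μ := by
        refine lintegral_mono fun x => ?_
        dsimp only
        rw [← ENNReal.prod_rpow_of_nonneg hr, ← Finset.prod_mul_distrib]
        gcongr with i
        rw [← ENNReal.mul_rpow_of_nonneg _ _ hr,
          ← lintegral_const_mul _ (show Measurable fun t => g (update x i t) from
            hgm.comp (measurable_update x))]
        gcongr
        exact hle i _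
    _ = (∏ i, I i) ^ r * ∫⁻ x, ∏ i, (∫⁻ t, g (update x i t) ∂μ i) ^ r ∂.pi μ := by
        refine lintegral_const_mul' _ _ (ENNReal.rpow_ne_top_of_nonneg hr ?_)
        exact ENNReal.prod_ne_top fun i _ => htop i
    _ ≤ (∏ i, I i) ^ r * (Fintype.card ι : ℝ≥0∞) ^ p := by
        gcongr
        rw [← hgint]
        exact lintegral_prod_lintegral_pow_le μ hp hgm

/-- A differentiable function on the line which vanishes at `-∞` is bounded by the integral of
its derivative. -/
theorem enorm_le_lintegral_enorm_of_hasDerivAt {E : Type*} [NormedAddCommGroup E]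
    [NormedSpace ℝ E] [CompleteSpace E] {f f' : ℝ → E} (hf : ∀ t, HasDerivAt f (f' t) t)
    (hf' : Continuous f') (h0 : Tendsto f atBot (𝓝 0)) (a : ℝ) :
    ‖f a‖ₑ ≤ ∫⁻ t, ‖f' t‖ₑ := by
  by_cases h : ∫⁻ t, ‖f' t‖ₑ = ∞
  · simp [h]
  have hint : Integrable f' := ⟨hf'.aestronglyMeasurable, lt_top_iff_ne_top.2 h⟩
  have := integral_Iic_of_hasDerivAt_of_tendsto' (a := a) (fun t _ => hf t) hint.integrableOn h0
  rw [sub_zero] at this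
  rw [← this]
  exact (enorm_integral_le_lintegral_enorm _).trans (setLIntegral_le_lintegral _ _)

/-- Pointwise bound of the square of a Schwartz function by the integral of its derivative along
a coordinate line. -/
theorem SchwartzMap.enorm_sq_le_lintegral_update {ι : Type*} [Fintype ι] [DecidableEq ι]
    (φ : SchwartzMap (EuclideanSpace ℝ ι) ℝ) (i : ι) (x : ι → ℝ) :
    ‖φ (WithLp.toLp 2 x)‖ₑ ^ 2 ≤
      ∫⁻ t, ‖2 * φ (WithLp.toLp 2 (update x i t)) *
        fderiv ℝ φ (WithLp.toLp 2 (update x i t)) (EuclideanSpace.single i 1)‖ₑ := by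
  have hline : ∀ t, HasDerivAt (fun t => WithLp.toLp 2 (update x i t))
      (EuclideanSpace.single i (1 : ℝ)) t := fun t =>
    (PiLp.hasFDerivAt_toLp (𝕜 := ℝ) 2 (update x i t)).comp_hasDerivAt t (hasDerivAt_update x i t)
  have hcont : Continuous fun t => WithLp.toLp 2 (update x i t) :=
    continuous_iff_continuousAt.2 fun t => (hline t).continuousAt
  have hφ : ∀ t, HasDerivAt (fun t => φ (WithLp.toLp 2 (update x i t)))
      (fderiv ℝ φ (WithLp.toLp 2 (update x i t)) (EuclideanSpace.single i 1)) t := fun t =>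
    (φ.differentiableAt.hasFDerivAt).comp_hasDerivAt t (hline t)
  have hd : Continuous (fderiv ℝ φ) := (φ.smooth 1).continuous_fderiv one_ne_zero
  have hlim : Tendsto (fun t => φ (WithLp.toLp 2 (update x i t))) atBot (𝓝 0) := by
    refine φ.tendsto_cocompact.comp ?_
    rw [← Metric.cobounded_eq_cocompact, ← tendsto_norm_atTop_iff_cobounded]
    refine tendsto_atTop_mono (fun t => ?_) tendsto_abs_atBot_atTop
    simpa using PiLp.norm_apply_le (WithLp.toLp 2 (update x i t)) i
  have := enorm_le_lintegral_enorm_of_hasDerivAt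
    (f := fun t => φ (WithLp.toLp 2 (update x i t)) ^ 2)
    (f' := fun t => 2 * φ (WithLp.toLp 2 (update x i t)) *
        fderiv ℝ φ (WithLp.toLp 2 (update x i t)) (EuclideanSpace.single i 1))
    (fun t => by simpa using (hφ t).fun_pow 2)
    ((continuous_const.mul (φ.continuous.comp hcont)).mul
      ((hd.comp hcont).clm_apply continuous_const))
    (by simpa using hlim.pow 2) (x i)
  simpa [enorm_pow] using this

theorem ENNReal.le_mul_rpow_of_rpow_three_le {a b : ℝ≥0∞} {c : ℝ≥0∞} (ha : a ≠ ∞)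
    (h : a ^ (3 : ℝ) ≤ (c * a) ^ (3 / 2 : ℝ) * b ^ (1 / 2 : ℝ)) :
    a ≤ c * b ^ (1 / 3 : ℝ) := by
  rcases eq_or_ne a 0 with rfl | h0
  · simp
  have h1 : a ^ (3 / 2 : ℝ) * a ^ (3 / 2 : ℝ) ≤
      a ^ (3 / 2 : ℝ) * (c ^ (3 / 2 : ℝ) * b ^ (1 / 2 : ℝ)) := by
    rw [← ENNReal.rpow_add _ _ h0 ha]
    convert h using 1
    · norm_num
    · rw [ENNReal.mul_rpow_of_nonneg _ _ (by norm_num)]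
      ring
  rw [ENNReal.mul_le_mul_iff_right (by simp [h0, ha]) (by simp [h0, ha])] at h1
  have h2 := ENNReal.rpow_le_rpow h1 (z := 2 / 3) (by norm_num)
  rw [ENNReal.mul_rpow_of_nonneg _ _ (by norm_num), ← ENNReal.rpow_mul, ← ENNReal.rpow_mul,
    ← ENNReal.rpow_mul] at h2
  norm_num at h2
  norm_num
  exact h2

theorem stmt_5 :
    ∃ C : ℝ≥0, 0 < C ∧
      ∀ φ : SchwartzMap (EuclideanSpace ℝ (Fin 3)) ℝ,
        eLpNorm (⇑φ) 3 volume ≤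
          C * (eLpNorm (fun x => fderiv ℝ φ x (EuclideanSpace.single 0 1)) (ENNReal.ofReal (3 / 2)) volume) ^ ((1 : ℝ) / 3)
            * (eLpNorm (fun x => fderiv ℝ φ x (EuclideanSpace.single 1 1)) (ENNReal.ofReal (3 / 2)) volume) ^ ((1 : ℝ) / 3)
            * (eLpNorm (fun x => fderiv ℝ φ x (EuclideanSpace.single 2 1)) (ENNReal.ofReal (3 / 2)) volume) ^ ((1 : ℝ) / 3) := by
  refine ⟨6, by norm_num, fun φ => ?_⟩
  set D : Fin 3 → EuclideanSpace ℝ (Fin 3) → ℝ :=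
    fun i x => fderiv ℝ φ x (EuclideanSpace.single i 1)
  have hDc : ∀ i, Continuous (D i) := fun i =>
    ((φ.smooth 1).continuous_fderiv one_ne_zero).clm_apply continuous_const
  have hDfin : ∀ i, eLpNorm (D i) (ENNReal.ofReal (3 / 2)) volume ≠ ∞ := fun i =>
    ((LineDeriv.lineDerivOp (EuclideanSpace.single i (1 : ℝ)) φ).memLp _ _).eLpNorm_ne_top
  have hfin : eLpNorm φ 3 volume ≠ ∞ := (φ.memLp 3 volume).eLpNorm_ne_top
  have hmp := PiLp.volume_preserving_toLp (Fin 3)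
  have hemb := (MeasurableEquiv.toLp 2 (Fin 3 → ℝ)).measurableEmbedding
  set f : Fin 3 → (Fin 3 → ℝ) → ℝ≥0∞ :=
    fun i x => ‖2 * φ (WithLp.toLp 2 x) * D i (WithLp.toLp 2 x)‖ₑ
  have hfc : ∀ i, Continuous (f i) := fun i => by
    have := hDc i
    have := φ.continuous
    fun_prop
  have hA3 : eLpNorm φ 3 volume ^ (3 : ℝ) =
      ∫⁻ x : Fin 3 → ℝ, ‖φ (WithLp.toLp 2 x)‖ₑ ^ (3 : ℝ) := by
    rw [hmp.lintegral_comp_emb hemb (fun y => ‖φ y‖ₑ ^ (3 : ℝ)),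
      eLpNorm_eq_lintegral_rpow_enorm_toReal (by norm_num) (by norm_num), ← ENNReal.rpow_mul]
    norm_num
  have hfle : ∀ i, ∫⁻ x, f i x ≤
      2 * eLpNorm φ 3 volume * eLpNorm (D i) (ENNReal.ofReal (3 / 2)) volume := fun i => by
    rw [hmp.lintegral_comp_emb hemb (fun y => ‖2 * φ y * D i y‖ₑ)]
    simp_rw [mul_assoc, enorm_mul]
    rw [lintegral_const_mul' _ _ (by simp)]
    have h2 : ‖(2 : ℝ)‖ₑ = 2 := by simp [enorm_eq_nnnorm]
    rw [h2]
    gcongr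
    have := ENNReal.lintegral_mul_le_Lp_mul_Lq volume
      (show Real.HolderConjugate 3 (3 / 2) by
        rw [Real.holderConjugate_iff]; norm_num)
      φ.continuous.enorm.aemeasurable (hDc i).enorm.aemeasurable
    rw [eLpNorm_eq_lintegral_rpow_enorm_toReal (by norm_num) (by norm_num),
      eLpNorm_eq_lintegral_rpow_enorm_toReal (by norm_num) (by norm_num),
      ENNReal.toReal_ofReal (by norm_num)]
    simpa using this
  have hftop : ∀ i, ∫⁻ x, f i x ≠ ∞ := fun i => ne_top_of_le_ne_top
    (ENNReal.mul_ne_top (ENNReal.mul_ne_top (by simp) hfin) (hDfin i)) (hfle i)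
  have hpt : ∀ i x, ‖φ (WithLp.toLp 2 x)‖ₑ ^ 2 ≤ ∫⁻ t, f i (update x i t) :=
    fun i x => φ.enorm_sq_le_lintegral_update i x
  by_cases h0 : ∃ i, ∫⁻ x, f i x = 0
  · obtain ⟨i, hi⟩ := h0
    have hfi : f i = 0 :=
      (Continuous.ae_eq_iff_eq volume (hfc i) continuous_const).1
        ((lintegral_eq_zero_iff (hfc i).measurable).1 hi)
    have hφ0 : (⇑φ) = 0 := by
      funext y
      simpa [hfi] using hpt i (WithLp.ofLp y)
    simp [hφ0]
  push Not at h0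
  have hLW := lintegral_prod_lintegral_update_pow_le (fun _ : Fin 3 => (volume : Measure ℝ))
    (p := 3 / 2) (by rw [Real.holderConjugate_iff]; norm_num)
    (fun i => (hfc i).measurable) h0 hftop
  rw [Fintype.card_fin, show 1 / (((3 : ℕ) : ℝ) - 1) = 1 / 2 by norm_num, Nat.cast_ofNat] at hLW
  have hmain : eLpNorm φ 3 volume ≤
      6 * (∏ i, eLpNorm (D i) (ENNReal.ofReal (3 / 2)) volume) ^ (1 / 3 : ℝ) := by
    refine ENNReal.le_mul_rpow_of_rpow_three_le hfin ?_
    calc eLpNorm φ 3 volume ^ (3 : ℝ)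
        = ∫⁻ x : Fin 3 → ℝ, ∏ i : Fin 3, (‖φ (WithLp.toLp 2 x)‖ₑ ^ 2) ^ (1 / 2 : ℝ) := by
          rw [hA3]
          congr! 2 with x
          rw [← ENNReal.rpow_natCast, ← ENNReal.rpow_mul]
          norm_num
      _ ≤ ∫⁻ x : Fin 3 → ℝ, ∏ i : Fin 3, (∫⁻ t, f i (update x i t)) ^ (1 / 2 : ℝ) := by
          gcongr with x i
          exact hpt i x
      _ ≤ (∏ i, ∫⁻ x, f i x) ^ (1 / 2 : ℝ) * 3 ^ (3 / 2 : ℝ) := by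
          exact hLW
      _ ≤ (∏ i, (2 * eLpNorm φ 3 volume * eLpNorm (D i) (ENNReal.ofReal (3 / 2)) volume))
            ^ (1 / 2 : ℝ) * 3 ^ (3 / 2 : ℝ) := by
          gcongr with i
          exact hfle i
      _ = (6 * eLpNorm φ 3 volume) ^ (3 / 2 : ℝ) *
            (∏ i, eLpNorm (D i) (ENNReal.ofReal (3 / 2)) volume) ^ (1 / 2 : ℝ) := by
          rw [Finset.prod_mul_distrib, Finset.prod_const, Finset.card_univ, Fintype.card_fin,
            ENNReal.mul_rpow_of_nonneg _ _ (by norm_num), ← ENNReal.rpow_natCast,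
            ← ENNReal.rpow_mul, mul_right_comm]
          congr 1
          rw [show ((3 : ℕ) : ℝ) * (1 / 2) = 3 / 2 by norm_num,
            ← ENNReal.mul_rpow_of_nonneg _ _ (by norm_num)]
          congr 1
          rw [mul_right_comm]
          norm_num
  rw [← ENNReal.prod_rpow_of_nonneg (by norm_num), Fin.prod_univ_three] at hmain
  simpa [mul_assoc] using hmain
end

section
/- Let φ : ℝ³ → ℝ be a Schwartz function, α > 0, 1 ≤ q < p < ∞, θ = q/p, β = α(p/q − 1). Suppose ‖φ‖_{Ḃ^{−α}_{∞,∞}} := sup_{j∈ℤ} 2^{−jα}‖Δ̇ⱼφ‖_{L^∞} < ∞ and ‖φ‖_{Ḃ^{β}_{q,q}} := (Σ_{j∈ℤ} 2^{jβq}‖Δ̇ⱼφ‖_{L^q}^q)^{1/q} < ∞, where Δ̇ⱼ are homogeneous Littlewood–Paley blocks. Then ‖φ‖_{L^p} ≤ C ‖φ‖_{Ḃ^{−α}_{∞,∞}}^{1−θ} ‖φ‖_{Ḃ^{β}_{q,q}}^{θ} for a constant C depending only on p, q, α. -/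
open MeasureTheory FourierTransform NNReal ENNReal

/-- The homogeneous Littlewood–Paley block `Δ̇ⱼ f = 𝓕⁻¹(ψ(2⁻ʲ·) 𝓕f)`, where `ψ` is a
fixed smooth function supported in an annulus. -/
noncomputable def LPblock (ψ : EuclideanSpace ℝ (Fin 3) → ℂ) (j : ℤ)
    (f : EuclideanSpace ℝ (Fin 3) → ℂ) : EuclideanSpace ℝ (Fin 3) → ℂ :=
  𝓕⁻ (fun ξ => ψ ((2 : ℝ) ^ (-j) • ξ) * 𝓕 f ξ)

/-- The homogeneous Besov norm `‖f‖_{Ḃ^{-α}_{∞,∞}} = sup_j 2^{-jα} ‖Δ̇ⱼ f‖_{L^∞}`. -/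
noncomputable def besovNegInf (ψ : EuclideanSpace ℝ (Fin 3) → ℂ) (α : ℝ)
    (f : EuclideanSpace ℝ (Fin 3) → ℂ) : ℝ≥0∞ :=
  ⨆ j : ℤ, ENNReal.ofReal ((2 : ℝ) ^ (-(j : ℝ) * α)) * eLpNorm (LPblock ψ j f) ⊤ volume

/-- The homogeneous Besov norm `‖f‖_{Ḃ^{β}_{q,q}} = (Σ_j 2^{jβq} ‖Δ̇ⱼ f‖_{L^q}^q)^{1/q}`. -/
noncomputable def besovQ (ψ : EuclideanSpace ℝ (Fin 3) → ℂ) (β q : ℝ)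
    (f : EuclideanSpace ℝ (Fin 3) → ℂ) : ℝ≥0∞ :=
  (∑' j : ℤ, (ENNReal.ofReal ((2 : ℝ) ^ ((j : ℝ) * β)) *
      eLpNorm (LPblock ψ j f) (ENNReal.ofReal q) volume) ^ q) ^ (1 / q)

/-- A sequence dominated by an increasing and by a decreasing geometric progression has its sum
controlled by the value at which the two progressions cross. -/
theorem exists_sum_le_rpow_mul_rpow {a d : ℝ} (ha : 0 < a) (hd : 0 < d) :
    ∃ C : ℝ, 0 < C ∧ ∀ (A B : ℝ) (f : ℤ → ℝ), 0 ≤ A → 0 ≤ B → (∀ j, 0 ≤ f j) →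
      (∀ j : ℤ, f j ≤ A * 2 ^ ((j : ℝ) * a)) → (∀ j : ℤ, f j ≤ B * 2 ^ (-((j : ℝ) * d))) →
      ∀ s : Finset ℤ, ∑ j ∈ s, f j ≤ C * A ^ (d / (a + d)) * B ^ (a / (a + d)) := by
  set e := min a d with he
  have he0 : 0 < e := lt_min ha hd
  have hsum : Summable fun j : ℤ => (2 : ℝ) ^ (e - e * |(j : ℝ)|) := by
    have h1 : Summable fun n : ℕ => (2 : ℝ) ^ (e - e * (n : ℝ)) := by
      have hr : (2 : ℝ) ^ (-e) < 1 := Real.rpow_lt_one_of_one_lt_of_neg (by norm_num) (by linarith)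
      refine ((summable_geometric_of_lt_one (by positivity) hr).mul_left ((2 : ℝ) ^ e)).congr ?_
      intro n
      rw [← Real.rpow_natCast, ← Real.rpow_mul (by norm_num), ← Real.rpow_add (by norm_num)]
      ring_nf
    exact Summable.of_nat_of_neg (by simpa using h1) (by simpa using h1)
  refine ⟨∑' j : ℤ, (2 : ℝ) ^ (e - e * |(j : ℝ)|),
    hsum.tsum_pos (fun _ => by positivity) 0 (by positivity), ?_⟩
  intro A B f hA hB hf hfA hfB s
  have htriv : (∀ j, f j ≤ 0) →
      ∑ j ∈ s, f j ≤ (∑' j : ℤ, (2 : ℝ) ^ (e - e * |(j : ℝ)|)) * A ^ (d / (a + d)) *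
        B ^ (a / (a + d)) := fun h =>
    (Finset.sum_nonpos fun j _ => h j).trans
      (mul_nonneg (mul_nonneg (tsum_nonneg fun _ => by positivity) (by positivity))
        (by positivity))
  rcases hA.eq_or_lt with rfl | hA
  · exact htriv fun j => by simpa using hfA j
  rcases hB.eq_or_lt with rfl | hB
  · exact htriv fun j => by simpa using hfB j
  obtain ⟨x, rfl⟩ : ∃ x : ℝ, (2 : ℝ) ^ x = A :=
    ⟨Real.logb 2 A, Real.rpow_logb (by norm_num) (by norm_num) hA⟩
  obtain ⟨y, rfl⟩ : ∃ y : ℝ, (2 : ℝ) ^ y = B :=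
    ⟨Real.logb 2 B, Real.rpow_logb (by norm_num) (by norm_num) hB⟩
  have had : a + d ≠ 0 := by positivity
  set t := (y - x) / (a + d) with ht
  set k := x * (d / (a + d)) + y * (a / (a + d)) with hk
  have hxk : x = k - t * a := by rw [hk, ht]; field_simp; ring
  have hyk : y = k + t * d := by rw [hk, ht]; field_simp; ring
  have hterm : ∀ j : ℤ, f j ≤ 2 ^ k * 2 ^ (e - e * |((j - ⌊t⌋ : ℤ) : ℝ)|) := by
    intro j
    have hea : e ≤ a := min_le_left _ _
    have hed : e ≤ d := min_le_right _ _
    rw [← Real.rpow_add (by norm_num)]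
    have hn1 := Int.floor_le t
    have hn2 := Int.lt_floor_add_one t
    push_cast
    rcases le_or_gt j ⌊t⌋ with hj | hj
    · have hj' : (j : ℝ) ≤ ⌊t⌋ := by exact_mod_cast hj
      refine (hfA j).trans ?_
      rw [← Real.rpow_add (by norm_num), abs_of_nonpos (by linarith)]
      refine Real.rpow_le_rpow_of_exponent_le (by norm_num) ?_
      rw [hxk]
      nlinarith
    · have hj' : (⌊t⌋ : ℝ) + 1 ≤ j := by exact_mod_cast hj
      refine (hfB j).trans ?_
      rw [← Real.rpow_add (by norm_num), abs_of_nonneg (by linarith)]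
      refine Real.rpow_le_rpow_of_exponent_le (by norm_num) ?_
      rw [hyk]
      nlinarith
  have hshift : Summable fun j : ℤ => (2 : ℝ) ^ (e - e * |((j - ⌊t⌋ : ℤ) : ℝ)|) :=
    (Equiv.subRight ⌊t⌋).summable_iff.mpr hsum
  calc ∑ j ∈ s, f j
      ≤ ∑ j ∈ s, 2 ^ k * (2 : ℝ) ^ (e - e * |((j - ⌊t⌋ : ℤ) : ℝ)|) :=
        Finset.sum_le_sum fun j _ => hterm j
    _ = 2 ^ k * ∑ j ∈ s, (2 : ℝ) ^ (e - e * |((j - ⌊t⌋ : ℤ) : ℝ)|) := by rw [Finset.mul_sum]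
    _ ≤ 2 ^ k * ∑' j : ℤ, (2 : ℝ) ^ (e - e * |((j - ⌊t⌋ : ℤ) : ℝ)|) := by
        gcongr
        exact hshift.sum_le_tsum s fun _ _ => by positivity
    _ = 2 ^ k * ∑' j : ℤ, (2 : ℝ) ^ (e - e * |(j : ℝ)|) := by
        congr 1
        exact (Equiv.subRight ⌊t⌋).tsum_eq fun j : ℤ => (2 : ℝ) ^ (e - e * |(j : ℝ)|)
    _ = _ := by
        rw [hk, Real.rpow_add (by norm_num), Real.rpow_mul (by norm_num),
          Real.rpow_mul (by norm_num)]
        ring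

section LittlewoodPaley

variable {ψ : EuclideanSpace ℝ (Fin 3) → ℂ}

theorem exists_norm_le_of_annulus (hψ : Continuous ψ)
    (hsupp : ∀ ξ, ψ ξ ≠ 0 → 3 / 4 ≤ ‖ξ‖ ∧ ‖ξ‖ ≤ 8 / 3) : ∃ M, ∀ ξ, ‖ψ ξ‖ ≤ M := by
  have hc : HasCompactSupport ψ :=
    HasCompactSupport.intro (isCompact_closedBall 0 (8 / 3)) fun ξ hξ => by
      by_contra h
      exact hξ (by simpa using (hsupp ξ h).2)
  exact hψ.bounded_above_of_compact_support hc

/-- At most three dyadic dilates of a function supported in the annulus overlap. -/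
theorem norm_sum_dilates_le {M : ℝ} (hM : ∀ ξ, ‖ψ ξ‖ ≤ M)
    (hsupp : ∀ ξ, ψ ξ ≠ 0 → 3 / 4 ≤ ‖ξ‖ ∧ ‖ξ‖ ≤ 8 / 3) {ξ : EuclideanSpace ℝ (Fin 3)}
    (hξ : ξ ≠ 0) (s : Finset ℤ) : ‖∑ j ∈ s, ψ ((2 : ℝ) ^ (-j) • ξ)‖ ≤ 3 * M := by
  obtain ⟨k, hk1, hk2⟩ := exists_mem_Ico_zpow (norm_pos_iff.mpr hξ) (one_lt_two (α := ℝ))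
  have hzero : ∀ j, j ∉ Finset.Icc (k - 1) (k + 1) → ψ ((2 : ℝ) ^ (-j) • ξ) = 0 := by
    intro j hj
    by_contra h
    obtain ⟨h1, h2⟩ := hsupp _ h
    rw [norm_smul, Real.norm_of_nonneg (by positivity)] at h1 h2
    refine hj (Finset.mem_Icc.mpr ⟨?_, ?_⟩)
    · have : (2 : ℝ) ^ (k - j) < 2 ^ (2 : ℤ) := by
        calc (2 : ℝ) ^ (k - j) = 2 ^ (-j) * 2 ^ k := by
              rw [← zpow_add₀ (by norm_num)]; ring_nf
          _ ≤ 2 ^ (-j) * ‖ξ‖ := by gcongr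
          _ < 2 ^ (2 : ℤ) := by linarith [show (2 : ℝ) ^ (2 : ℤ) = 4 by norm_num]
      have := (zpow_lt_zpow_iff_right₀ (by norm_num)).mp this
      omega
    · have : (2 : ℝ) ^ (-1 : ℤ) < 2 ^ (k + 1 - j) := by
        calc (2 : ℝ) ^ (-1 : ℤ) < 2 ^ (-j) * ‖ξ‖ := lt_of_lt_of_le (by norm_num) h1
          _ ≤ 2 ^ (-j) * 2 ^ (k + 1) := by gcongr
          _ = 2 ^ (k + 1 - j) := by rw [← zpow_add₀ (by norm_num)]; ring_nf
      have := (zpow_lt_zpow_iff_right₀ (by norm_num)).mp this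
      omega
  calc ‖∑ j ∈ s, ψ ((2 : ℝ) ^ (-j) • ξ)‖ ≤ ∑ j ∈ s, ‖ψ ((2 : ℝ) ^ (-j) • ξ)‖ :=
        norm_sum_le _ _
    _ ≤ ∑ j ∈ s ∪ Finset.Icc (k - 1) (k + 1), ‖ψ ((2 : ℝ) ^ (-j) • ξ)‖ :=
        Finset.sum_le_sum_of_subset_of_nonneg Finset.subset_union_left fun _ _ _ => norm_nonneg _
    _ = ∑ j ∈ Finset.Icc (k - 1) (k + 1), ‖ψ ((2 : ℝ) ^ (-j) • ξ)‖ :=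
        (Finset.sum_subset Finset.subset_union_right fun j _ hj => by rw [hzero j hj, norm_zero]).symm
    _ ≤ ∑ j ∈ Finset.Icc (k - 1) (k + 1), M := Finset.sum_le_sum fun j _ => hM _
    _ = 3 * M := by
        rw [Finset.sum_const, Int.card_Icc, nsmul_eq_mul]
        congr 1
        have : (k + 1 + 1 - (k - 1)).toNat = 3 := by omega
        rw [this]
        norm_num

theorem integrable_dilate_mul_fourier (hψ : Continuous ψ) {M : ℝ} (hM : ∀ ξ, ‖ψ ξ‖ ≤ M)
    (φ : SchwartzMap (EuclideanSpace ℝ (Fin 3)) ℂ) (j : ℤ) :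
    Integrable fun ξ => ψ ((2 : ℝ) ^ (-j) • ξ) * 𝓕 (φ : EuclideanSpace ℝ (Fin 3) → ℂ) ξ :=
  (𝓕 φ).integrable.bdd_mul (c := M)
    (hψ.comp (continuous_const_smul _)).aestronglyMeasurable (.of_forall fun _ => hM _)

theorem continuous_LPblock (hψ : Continuous ψ) {M : ℝ} (hM : ∀ ξ, ‖ψ ξ‖ ≤ M)
    (φ : SchwartzMap (EuclideanSpace ℝ (Fin 3)) ℂ) (j : ℤ) : Continuous (LPblock ψ j φ) :=
  VectorFourier.fourierIntegral_continuous Real.continuous_fourierChar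
    (by simp only [LinearMap.neg_apply, innerₗ_apply_apply]; exact continuous_inner.neg)
    (integrable_dilate_mul_fourier hψ hM φ j)

/-- The Littlewood–Paley decomposition of a Schwartz function converges pointwise. -/
theorem hasSum_LPblock (hψ : Continuous ψ)
    (hsupp : ∀ ξ, ψ ξ ≠ 0 → 3 / 4 ≤ ‖ξ‖ ∧ ‖ξ‖ ≤ 8 / 3)
    (hone : ∀ ξ : EuclideanSpace ℝ (Fin 3), ξ ≠ 0 →
      HasSum (fun j : ℤ => ψ ((2 : ℝ) ^ (-j) • ξ)) 1)
    (φ : SchwartzMap (EuclideanSpace ℝ (Fin 3)) ℂ) (x : EuclideanSpace ℝ (Fin 3)) :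
    HasSum (fun j => LPblock ψ j φ x) (φ x) := by
  obtain ⟨M, hM⟩ := exists_norm_le_of_annulus hψ hsupp
  have hint := integrable_dilate_mul_fourier hψ hM φ
  have hinv : φ x = 𝓕⁻ (𝓕 (φ : EuclideanSpace ℝ (Fin 3) → ℂ)) x := by
    rw [← SchwartzMap.fourier_coe, ← SchwartzMap.fourierInv_coe,
      FourierTransform.fourierInv_fourier_eq]
  rw [hinv, HasSum, SummationFilter.unconditional_filter]
  have hpart : ∀ s : Finset ℤ, ∑ j ∈ s, LPblock ψ j φ x = ∫ ξ, ∑ j ∈ s,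
      Real.fourierChar (inner ℝ ξ x) •
        (ψ ((2 : ℝ) ^ (-j) • ξ) * 𝓕 (φ : EuclideanSpace ℝ (Fin 3) → ℂ) ξ) := by
    intro s
    rw [integral_finsetSum]
    · simp only [LPblock, Real.fourierInv_eq]
    · intro j _
      have := (Real.fourierIntegral_convergent_iff (-x)).mpr (hint j)
      simpa using this
  simp_rw [hpart]
  rw [Real.fourierInv_eq]
  have hne : ∀ᵐ ξ : EuclideanSpace ℝ (Fin 3), ξ ≠ 0 := by
    simp [ae_iff]
  refine tendsto_integral_filter_of_dominated_convergence
    (fun ξ => 3 * M * ‖𝓕 φ ξ‖) (.of_forall fun s => ?_) (.of_forall fun s => ?_)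
    ((𝓕 φ).integrable.norm.const_mul _) ?_
  · refine Finset.aestronglyMeasurable_fun_sum _ fun j _ => ?_
    have := (Real.fourierIntegral_convergent_iff (-x)).mpr (hint j)
    simpa using this.aestronglyMeasurable
  · filter_upwards [hne] with ξ hξ
    rw [← Finset.smul_sum, ← Finset.sum_mul, Circle.norm_smul, norm_mul]
    exact mul_le_mul_of_nonneg_right (norm_sum_dilates_le hM hsupp hξ s) (norm_nonneg _)
  · filter_upwards [hne] with ξ hξ
    have := ((hone ξ hξ).mul_right (𝓕 (φ : EuclideanSpace ℝ (Fin 3) → ℂ) ξ)).const_smul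
      (Real.fourierChar (inner ℝ ξ x))
    simpa [HasSum] using this

end LittlewoodPaley

theorem ae_enorm_LPblock_le_besovNegInf (ψ : EuclideanSpace ℝ (Fin 3) → ℂ) (α : ℝ)
    (f : EuclideanSpace ℝ (Fin 3) → ℂ) :
    ∀ᵐ x, ∀ j : ℤ, ‖LPblock ψ j f x‖ₑ ≤
      besovNegInf ψ α f * ENNReal.ofReal ((2 : ℝ) ^ ((j : ℝ) * α)) := by
  refine ae_all_iff.mpr fun j => ?_
  filter_upwards [enorm_ae_le_eLpNormEssSup (LPblock ψ j f) volume] with x hx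
  have h1 : ENNReal.ofReal ((2 : ℝ) ^ (-(j : ℝ) * α)) *
      ENNReal.ofReal ((2 : ℝ) ^ ((j : ℝ) * α)) = 1 := by
    rw [← ENNReal.ofReal_mul (by positivity), ← Real.rpow_add (by norm_num)]
    simp
  calc ‖LPblock ψ j f x‖ₑ ≤ eLpNorm (LPblock ψ j f) ⊤ volume := by rwa [eLpNorm_exponent_top]
    _ = (ENNReal.ofReal ((2 : ℝ) ^ (-(j : ℝ) * α)) * eLpNorm (LPblock ψ j f) ⊤ volume) *
        ENNReal.ofReal ((2 : ℝ) ^ ((j : ℝ) * α)) := by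
        rw [mul_right_comm, h1, one_mul]
    _ ≤ _ := by
        gcongr
        exact le_iSup (fun j : ℤ => ENNReal.ofReal ((2 : ℝ) ^ (-(j : ℝ) * α)) *
          eLpNorm (LPblock ψ j f) ⊤ volume) j

theorem lintegral_tsum_LPblock_rpow {ψ f : EuclideanSpace ℝ (Fin 3) → ℂ} {β q : ℝ} (hq : 0 < q)
    (hmeas : ∀ j, AEStronglyMeasurable (LPblock ψ j f)) :
    ∫⁻ x, ∑' j : ℤ, (ENNReal.ofReal ((2 : ℝ) ^ ((j : ℝ) * β)) * ‖LPblock ψ j f x‖ₑ) ^ q =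
      besovQ ψ β q f ^ q := by
  rw [lintegral_tsum fun j => ((hmeas j).enorm.const_mul _).pow_const q, besovQ,
    ← ENNReal.rpow_mul, one_div_mul_cancel hq.ne', ENNReal.rpow_one]
  refine tsum_congr fun j => ?_
  simp_rw [ENNReal.mul_rpow_of_nonneg _ _ hq.le]
  rw [lintegral_const_mul'' _ ((hmeas j).enorm.pow_const q),
    eLpNorm_eq_lintegral_rpow_enorm_toReal (by simpa using hq) ENNReal.ofReal_ne_top,
    ENNReal.toReal_ofReal hq.le, ← ENNReal.rpow_mul, one_div_mul_cancel hq.ne', ENNReal.rpow_one]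

theorem stmt_15 (p q α : ℝ) (hq : 1 ≤ q) (hqp : q < p) (hα : 0 < α) :
    ∃ C : ℝ≥0, 0 < C ∧
      ∀ (ψ : EuclideanSpace ℝ (Fin 3) → ℂ)
        (φ : SchwartzMap (EuclideanSpace ℝ (Fin 3)) ℂ),
        ContDiff ℝ (⊤ : ℕ∞) ψ →
        (∀ ξ, ψ ξ ≠ 0 → 3 / 4 ≤ ‖ξ‖ ∧ ‖ξ‖ ≤ 8 / 3) →
        (∀ ξ : EuclideanSpace ℝ (Fin 3), ξ ≠ 0 →
          HasSum (fun j : ℤ => ψ ((2 : ℝ) ^ (-j) • ξ)) 1) →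
        besovNegInf ψ α (⇑φ) ≠ ⊤ →
        besovQ ψ (α * (p / q - 1)) q (⇑φ) ≠ ⊤ →
        eLpNorm (⇑φ) (ENNReal.ofReal p) volume ≤
          C * besovNegInf ψ α (⇑φ) ^ (1 - q / p) *
            besovQ ψ (α * (p / q - 1)) q (⇑φ) ^ (q / p) := by
  have hq0 : 0 < q := by linarith
  have hp0 : 0 < p := by linarith
  have hβ : 0 < α * (p / q - 1) := mul_pos hα (sub_pos.mpr ((one_lt_div hq0).mpr hqp))
  obtain ⟨C, hC, hsum⟩ := exists_sum_le_rpow_mul_rpow hα hβ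
  refine ⟨C.toNNReal, Real.toNNReal_pos.mpr hC, fun ψ φ hψ hsupp hone hA hB => ?_⟩
  set β := α * (p / q - 1) with hβdef
  set A := besovNegInf ψ α φ
  have hαβ : α + β = α * p / q := by rw [hβdef]; ring
  have hexpA : β / (α + β) = 1 - q / p := by
    rw [hαβ, hβdef]
    field_simp
  have hexpB : α / (α + β) = q / p := by
    rw [hαβ]
    field_simp
  have hθ : 0 ≤ 1 - q / p := sub_nonneg.mpr ((div_le_one hp0).mpr hqp.le)
  obtain ⟨M, hM⟩ := exists_norm_le_of_annulus hψ.continuous hsupp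
  have hmeas : ∀ j, AEStronglyMeasurable (LPblock ψ j φ) := fun j =>
    (continuous_LPblock hψ.continuous hM φ j).aestronglyMeasurable
  set R : EuclideanSpace ℝ (Fin 3) → ℝ≥0∞ := fun x =>
    ∑' j : ℤ, (ENNReal.ofReal ((2 : ℝ) ^ ((j : ℝ) * β)) * ‖LPblock ψ j φ x‖ₑ) ^ q with hR
  have hRint : ∫⁻ x, R x = besovQ ψ β q φ ^ q := lintegral_tsum_LPblock_rpow hq0 hmeas
  have hRmeas : AEMeasurable R :=
    AEMeasurable.tsum fun j => ((hmeas j).enorm.const_mul _).pow_const q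
  have hRfin : ∀ᵐ x, R x < ⊤ :=
    ae_lt_top' hRmeas (by rw [hRint]; exact ENNReal.rpow_ne_top_of_nonneg hq0.le hB)
  have hpt : ∀ᵐ x, ‖φ x‖ₑ ≤ ENNReal.ofReal C * A ^ (1 - q / p) * R x ^ (1 / p) := by
    filter_upwards [hRfin, ae_enorm_LPblock_le_besovNegInf ψ α φ] with x hRx hAx
    have hRx' : R x ^ (1 / q) ≠ ⊤ := ENNReal.rpow_ne_top_of_nonneg (by positivity) hRx.ne
    have hfA : ∀ j : ℤ, ‖LPblock ψ j φ x‖ ≤ A.toReal * 2 ^ ((j : ℝ) * α) := by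
      intro j
      have := ENNReal.toReal_mono (ENNReal.mul_ne_top hA ENNReal.ofReal_ne_top) (hAx j)
      rwa [toReal_enorm, ENNReal.toReal_mul, ENNReal.toReal_ofReal (by positivity)] at this
    have hfB : ∀ j : ℤ, ‖LPblock ψ j φ x‖ ≤ (R x ^ (1 / q)).toReal * 2 ^ (-((j : ℝ) * β)) := by
      intro j
      have h1 : ENNReal.ofReal ((2 : ℝ) ^ ((j : ℝ) * β)) * ‖LPblock ψ j φ x‖ₑ ≤
          R x ^ (1 / q) := by
        rw [one_div, ENNReal.le_rpow_inv_iff hq0]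
        exact ENNReal.le_tsum j
      have h2 := ENNReal.toReal_mono hRx' h1
      rw [ENNReal.toReal_mul, toReal_enorm, ENNReal.toReal_ofReal (by positivity)] at h2
      rwa [Real.rpow_neg (by norm_num), ← div_eq_mul_inv, le_div_iff₀' (by positivity)]
    have hle : ‖φ x‖ ≤ C * A.toReal ^ (1 - q / p) * (R x ^ (1 / q)).toReal ^ (q / p) := by
      rw [← hexpA, ← hexpB]
      refine le_of_tendsto
        (hasSum_LPblock hψ.continuous hsupp hone φ x).norm (.of_forall fun s => ?_)
      exact (norm_sum_le _ _).trans (hsum _ _ _ ENNReal.toReal_nonneg ENNReal.toReal_nonneg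
        (fun _ => norm_nonneg _) hfA hfB s)
    have hRpow : R x ^ (1 / p) = (R x ^ (1 / q)) ^ (q / p) := by
      rw [← ENNReal.rpow_mul]
      congr 1
      field_simp
    rw [hRpow, ← ofReal_norm]
    refine (ENNReal.ofReal_le_ofReal hle).trans_eq ?_
    rw [ENNReal.ofReal_mul (by positivity), ENNReal.ofReal_mul hC.le,
      ENNReal.toReal_rpow, ENNReal.toReal_rpow,
      ENNReal.ofReal_toReal (ENNReal.rpow_ne_top_of_nonneg hθ hA),
      ENNReal.ofReal_toReal (ENNReal.rpow_ne_top_of_nonneg (by positivity) hRx')]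
  change _ ≤ ENNReal.ofReal C * _ * _
  rw [eLpNorm_eq_lintegral_rpow_enorm_toReal (by simpa using hp0) ENNReal.ofReal_ne_top,
    ENNReal.toReal_ofReal hp0.le]
  calc (∫⁻ x, ‖φ x‖ₑ ^ p) ^ (1 / p)
      ≤ (∫⁻ x, (ENNReal.ofReal C * A ^ (1 - q / p)) ^ p * R x) ^ (1 / p) := by
        refine ENNReal.rpow_le_rpow (lintegral_mono_ae ?_) (by positivity)
        filter_upwards [hpt] with x hx
        refine (ENNReal.rpow_le_rpow hx hp0.le).trans_eq ?_
        rw [ENNReal.mul_rpow_of_nonneg _ _ hp0.le, ← ENNReal.rpow_mul (R x),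
          one_div_mul_cancel hp0.ne', ENNReal.rpow_one]
    _ = ENNReal.ofReal C * A ^ (1 - q / p) * besovQ ψ β q φ ^ (q / p) := by
        rw [lintegral_const_mul'' _ hRmeas, hRint,
          ENNReal.mul_rpow_of_nonneg _ _ (by positivity), ← ENNReal.rpow_mul,
          ← ENNReal.rpow_mul, mul_one_div_cancel hp0.ne', ENNReal.rpow_one, mul_one_div]
end
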